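/- arXiv:2110.09553 — 4 statements merged into one kernel-verified Lean document; each statement's English description precedes it below -/
import Mathlib

section
/- Let s : {0,1,...,5} → ℤ be strictly increasing and let c be an odd integer. Then there are exactly 3 pairs (i, j) with 0 ≤ i < j ≤ 5 and s(i) + s(j) = c if and only if s(i) + s(5−i) = c for every i ∈ {0,...,5}. -/
/-- If every value of a strictly monotone `s` has a partner with which it sums to `c`, then
the partner of `s i` is `s i.rev`. -/
theorem StrictMono.add_rev_eq_of_forall_exists {n : ℕ} {s : Fin n → ℤ} (hs : StrictMono s)
    {c : ℤ} (h : ∀ i, ∃ j, s i + s j = c) (i : Fin n) : s i + s i.rev = c := by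
  choose f hf using h
  have hmono : StrictMono fun i : Fin n => f i.rev := by
    intro a b hab
    have hlt : s b.rev < s a.rev := hs (Fin.rev_lt_rev.mpr hab)
    have ha := hf a.rev
    have hb := hf b.rev
    exact hs.lt_iff_lt.mp (by lia)
  have hid : (fun i : Fin n => f i.rev) = id :=
    hmono.eq_id
  have hrev : f i = i.rev := by simpa using congrFun hid i.rev
  rw [← hrev]
  exact hf i

/-- The pairs `i < j` with `s i + s j = c` are disjoint, so together their entries make up
twice as many indices as there are pairs. -/
theorem Function.Injective.card_image_fst_union_image_snd {n : ℕ} {s : Fin n → ℤ}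
    (hs : Function.Injective s) {c : ℤ} {F : Finset (Fin n × Fin n)}
    (hF : ∀ p ∈ F, p.1 < p.2 ∧ s p.1 + s p.2 = c) :
    (F.image Prod.fst ∪ F.image Prod.snd).card = 2 * F.card := by
  rw [Finset.card_union_of_disjoint, Finset.card_image_of_injOn, Finset.card_image_of_injOn,
    two_mul]
  · intro p hp q hq hpq
    have h₁ := (hF p hp).2
    have h₂ := (hF q hq).2
    rw [hpq] at h₁
    exact Prod.ext (hs (by lia)) hpq
  · intro p hp q hq hpq
    have h₁ := (hF p hp).2
    have h₂ := (hF q hq).2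
    rw [hpq] at h₁
    exact Prod.ext hpq (hs (by lia))
  · rw [Finset.disjoint_left]
    intro a ha hb
    obtain ⟨p, hp, rfl⟩ := Finset.mem_image.mp ha
    obtain ⟨q, hq, hqp⟩ := Finset.mem_image.mp hb
    obtain ⟨hp₁, hp₂⟩ := hF p hp
    obtain ⟨hq₁, hq₂⟩ := hF q hq
    rw [hqp] at hq₁ hq₂
    have hpq : p.2 = q.1 := hs (by lia)
    rw [hpq] at hp₁
    exact lt_asymm hp₁ hq₁

/-- **Counting step in Lemma 4.10 (lem:countpermissible).** Let `s : Fin 6 → ℤ` be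
strictly increasing and let `c` be an odd integer.  Then there are exactly `3`
pairs `(i, j)` with `i < j` and `s i + s j = c` if and only if
`s i + s (5 - i) = c` for every `i`. -/
theorem stmt_2 (s : Fin 6 → ℤ) (hs : StrictMono s) (c : ℤ) (hc : Odd c) :
    ((Finset.univ : Finset (Fin 6 × Fin 6)).filter
        (fun p => p.1 < p.2 ∧ s p.1 + s p.2 = c)).card = 3 ↔
      ∀ i : Fin 6, s i + s i.rev = c := by
  constructor
  · intro h
    apply hs.add_rev_eq_of_forall_exists
    have hcard := hs.injective.card_image_fst_union_image_snd (c := c) (F := Finset.univ.filter _)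
      (fun p hp => (Finset.mem_filter.mp hp).2)
    rw [h] at hcard
    have huniv := (Finset.card_eq_iff_eq_univ _).mp hcard
    intro i
    have hi := Finset.mem_univ i
    rw [← huniv, Finset.mem_union, Finset.mem_image, Finset.mem_image] at hi
    rcases hi with ⟨p, hp, rfl⟩ | ⟨p, hp, rfl⟩
    · exact ⟨p.2, (Finset.mem_filter.mp hp).2.2⟩
    · exact ⟨p.1, by rw [add_comm]; exact (Finset.mem_filter.mp hp).2.2⟩
  · intro h
    have hiff (p : Fin 6 × Fin 6) : s p.1 + s p.2 = c ↔ p.2 = p.1.rev := by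
      rw [← h p.1, add_right_inj, hs.injective.eq_iff]
    simp only [hiff]
    decide
end

section
/- Fix ℓ ∈ {1,...,13} and a function inc from {1,...,13}∖{ℓ} to {0,...,5} attaining every value exactly twice. Define s_k : {0,...,5} → ℤ for k = 0,...,13 by s_0(i) = i − 2 and, for k ≥ 1, s_k(i) = s_{k−1}(i) + 1 if k ≠ ℓ and inc(k) = i, and s_k(i) = s_{k−1}(i) otherwise. Assume each s_k is strictly increasing. Set z_1 = min(6, ℓ), z_2 = max(7, ℓ), and for k ∈ {1,...,13} set σ(k) = 4 if k ≤ z_1, σ(k) = 3 if z_1 < k ≤ z_2, and σ(k) = 2 if z_2 < k. Say that loop k admits a new permissible pair if there exist 0 ≤ i ≤ j ≤ 5 with s_{k−1}(i) + s_{k−1}(j) ≤ σ(k) − 1 and s_k(i) + s_k(j) ≥ σ(k). Then for every k ∈ {1,...,13}, loop k admits no new permissible pair if and only if k = ℓ, or (ℓ > 6 and k = 6), or (ℓ > 7 and k = 7), or (ℓ < 9 and k = 9), or (ℓ ≤ 7 and s_7(5) = 4 and k = 8). -/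
/-- The slope vector whose displacements from the initial vector `i - 2` form the two-row
Young diagram with rows of lengths `a` and `b`. -/
def diagramSlope (a b : ℕ) (i : Fin 6) : ℤ :=
  ((i : ℕ) : ℤ) - 2 + (if 6 ≤ (i : ℕ) + a then 1 else 0) + (if 6 ≤ (i : ℕ) + b then 1 else 0)

set_option synthInstance.maxSize 2000 in
set_option synthInstance.maxHeartbeats 200000 in
/-- If raising the slope of a diagram by one in column `v` gives a strictly increasing slope
vector with displacements at most two, then a box has been added to one of the two rows. -/
theorem diagramSlope_add_box :
    ∀ a < 7, ∀ b < a + 1, ∀ v : Fin 6,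
      (∀ i j : Fin 6, i < j → diagramSlope a b i + (if v = i then 1 else 0) <
        diagramSlope a b j + (if v = j then 1 else 0)) →
      (∀ i : Fin 6, diagramSlope a b i + (if v = i then 1 else 0) ≤ ((i : ℕ) : ℤ)) →
      (a + 1 < 7 ∧ ∀ i : Fin 6,
        diagramSlope a b i + (if v = i then 1 else 0) = diagramSlope (a + 1) b i) ∨
      (b + 1 ≤ a ∧ ∀ i : Fin 6,
        diagramSlope a b i + (if v = i then 1 else 0) = diagramSlope a (b + 1) i) := by
  decide +kernel

/-- The prescribed slope of the independence on the bridge following loop `k`. -/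
def blockSlope (ℓ k : ℕ) : ℤ :=
  if k ≤ min 6 ℓ then 4 else if k ≤ max 7 ℓ then 3 else 2

/-- Passing from slope vector `t` to slope vector `u` creates a new permissible pair with respect
to the slope `c`. -/
def HasNewPair (c : ℤ) (t u : Fin 6 → ℤ) : Prop :=
  ∃ i j : Fin 6, i ≤ j ∧ t i + t j ≤ c - 1 ∧ c ≤ u i + u j

instance (c : ℤ) (t u : Fin 6 → ℤ) : Decidable (HasNewPair c t u) :=
  inferInstanceAs (Decidable (∃ i j : Fin 6, i ≤ j ∧ t i + t j ≤ c - 1 ∧ c ≤ u i + u j))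

/-- The loops without a new permissible pair, where `t` is the slope vector before loop `k`. -/
def IsExceptional (ℓ k : ℕ) (t : Fin 6 → ℤ) : Prop :=
  (6 < ℓ ∧ k = 6) ∨ (7 < ℓ ∧ k = 7) ∨ (ℓ < 9 ∧ k = 9) ∨ (ℓ ≤ 7 ∧ t 5 = 4 ∧ k = 8)

instance (ℓ k : ℕ) (t : Fin 6 → ℤ) : Decidable (IsExceptional ℓ k t) :=
  inferInstanceAs (Decidable
    ((6 < ℓ ∧ k = 6) ∨ (7 < ℓ ∧ k = 7) ∨ (ℓ < 9 ∧ k = 9) ∨ (ℓ ≤ 7 ∧ t 5 = 4 ∧ k = 8)))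

/-- The loop other than `ℓ` that is preceded by exactly `n` loops other than `ℓ`. -/
def nextLoop (ℓ n : ℕ) : ℕ :=
  if n + 1 < ℓ then n + 1 else n + 2

set_option synthInstance.maxSize 2000 in
set_option synthInstance.maxHeartbeats 200000 in
/-- Adding a box to a diagram of size `a + b`, at a loop `k` other than the lingering one, creates
no new permissible pair exactly at the exceptional loops. -/
theorem not_hasNewPair_diagramSlope_iff :
    ∀ ℓ < 14, ∀ a < 7, ∀ b < a + 1,
      (a + 1 < 7 → (¬ HasNewPair (blockSlope ℓ (nextLoop ℓ (a + b)))
          (diagramSlope a b) (diagramSlope (a + 1) b) ↔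
        IsExceptional ℓ (nextLoop ℓ (a + b)) (diagramSlope a b))) ∧
      (b + 1 ≤ a → (¬ HasNewPair (blockSlope ℓ (nextLoop ℓ (a + b)))
          (diagramSlope a b) (diagramSlope a (b + 1)) ↔
        IsExceptional ℓ (nextLoop ℓ (a + b)) (diagramSlope a b))) := by
  decide +kernel

/-- The slope of column `i` after loop `k` counts the increments of that column so far. -/
theorem slope_eq_add_card (ℓ : ℕ) (inc : ℕ → Fin 6) (s : ℕ → Fin 6 → ℤ)
    (hs0 : ∀ i : Fin 6, s 0 i = ((i : ℕ) : ℤ) - 2)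
    (hstep : ∀ k, 1 ≤ k → k ≤ 13 → ∀ i : Fin 6,
      s k i = s (k - 1) i + (if k ≠ ℓ ∧ inc k = i then 1 else 0))
    (i : Fin 6) (k : ℕ) (hk : k ≤ 13) :
    s k i = ((i : ℕ) : ℤ) - 2 +
      (((Finset.Icc 1 k).filter (fun m => m ≠ ℓ ∧ inc m = i)).card : ℤ) := by
  induction k with
  | zero => simp [hs0]
  | succ k ih =>
    rw [hstep (k + 1) (by omega) hk i, Nat.add_sub_cancel, ih (by omega),
      ← Finset.insert_Icc_right_eq_Icc_add_one (by omega), Finset.filter_insert]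
    split_ifs with h
    · rw [Finset.card_insert_of_notMem (by simp)]
      push_cast
      ring
    · simp

/-- Displacements are at most two when every column receives exactly two increments. -/
theorem slope_le (ℓ : ℕ) (inc : ℕ → Fin 6)
    (hinc : ∀ v : Fin 6,
      (((Finset.Icc 1 13).erase ℓ).filter (fun k => inc k = v)).card = 2)
    (s : ℕ → Fin 6 → ℤ)
    (hs0 : ∀ i : Fin 6, s 0 i = ((i : ℕ) : ℤ) - 2)
    (hstep : ∀ k, 1 ≤ k → k ≤ 13 → ∀ i : Fin 6,
      s k i = s (k - 1) i + (if k ≠ ℓ ∧ inc k = i then 1 else 0))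
    (k : ℕ) (hk : k ≤ 13) (i : Fin 6) :
    s k i ≤ ((i : ℕ) : ℤ) := by
  have hsub : (Finset.Icc 1 k).filter (fun m => m ≠ ℓ ∧ inc m = i) ⊆
      ((Finset.Icc 1 13).erase ℓ).filter (fun m => inc m = i) := by
    intro m
    simp only [Finset.mem_filter, Finset.mem_erase, Finset.mem_Icc]
    rintro ⟨⟨h1, h2⟩, h3, h4⟩
    exact ⟨⟨h3, h1, h2.trans hk⟩, h4⟩
  have hcard := Finset.card_le_card hsub
  rw [hinc i] at hcard
  rw [slope_eq_add_card ℓ inc s hs0 hstep i k hk]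
  omega

/-- Away from the lingering loop, the slope vector changes by adding a box to its diagram. -/
theorem diagramSlope_step (ℓ : ℕ) (inc : ℕ → Fin 6)
    (hinc : ∀ v : Fin 6,
      (((Finset.Icc 1 13).erase ℓ).filter (fun k => inc k = v)).card = 2)
    (s : ℕ → Fin 6 → ℤ)
    (hs0 : ∀ i : Fin 6, s 0 i = ((i : ℕ) : ℤ) - 2)
    (hstep : ∀ k, 1 ≤ k → k ≤ 13 → ∀ i : Fin 6,
      s k i = s (k - 1) i + (if k ≠ ℓ ∧ inc k = i then 1 else 0))
    (hmono : ∀ k, k ≤ 13 → StrictMono (s k))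
    (k : ℕ) (hk : k + 1 ≤ 13) (hkℓ : k + 1 ≠ ℓ) (a b : ℕ) (ha : a < 7) (hb : b ≤ a)
    (hs : s k = diagramSlope a b) :
    (a + 1 < 7 ∧ s (k + 1) = diagramSlope (a + 1) b) ∨
      (b + 1 ≤ a ∧ s (k + 1) = diagramSlope a (b + 1)) := by
  have hnext (i : Fin 6) :
      s (k + 1) i = diagramSlope a b i + (if inc (k + 1) = i then 1 else 0) := by
    simpa [hkℓ, hs] using hstep (k + 1) (by omega) hk i
  have h := diagramSlope_add_box a ha b (by omega) (inc (k + 1))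
  simp only [← hnext] at h
  simpa only [funext_iff] using
    h (fun i j hij => hmono (k + 1) hk hij) (slope_le ℓ inc hinc s hs0 hstep (k + 1) hk)

/-- Every slope vector comes from a two-row diagram, whose size counts the loops passed so far
other than the lingering one. -/
theorem exists_eq_diagramSlope (ℓ : ℕ) (hℓ1 : 1 ≤ ℓ) (inc : ℕ → Fin 6)
    (hinc : ∀ v : Fin 6,
      (((Finset.Icc 1 13).erase ℓ).filter (fun k => inc k = v)).card = 2)
    (s : ℕ → Fin 6 → ℤ)
    (hs0 : ∀ i : Fin 6, s 0 i = ((i : ℕ) : ℤ) - 2)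
    (hstep : ∀ k, 1 ≤ k → k ≤ 13 → ∀ i : Fin 6,
      s k i = s (k - 1) i + (if k ≠ ℓ ∧ inc k = i then 1 else 0))
    (hmono : ∀ k, k ≤ 13 → StrictMono (s k))
    (k : ℕ) (hk : k ≤ 13) :
    ∃ a b : ℕ, a < 7 ∧ b ≤ a ∧ (a + b = if k < ℓ then k else k - 1) ∧
      s k = diagramSlope a b := by
  induction k with
  | zero =>
    refine ⟨0, 0, by omega, le_rfl, by simp, ?_⟩
    ext i
    have := i.isLt
    simp [hs0, diagramSlope, this.not_ge]
  | succ k ih =>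
    obtain ⟨a, b, ha, hb, hab, hs⟩ := ih (by omega)
    by_cases hkℓ : k + 1 = ℓ
    · refine ⟨a, b, ha, hb, by split_ifs at hab ⊢ <;> omega, ?_⟩
      rw [← hs]
      ext i
      rw [hstep (k + 1) (by omega) hk i, if_neg (by simp [hkℓ]), Nat.add_sub_cancel, add_zero]
    · rcases diagramSlope_step ℓ inc hinc s hs0 hstep hmono k hk hkℓ a b ha hb hs with
        ⟨h, hs'⟩ | ⟨h, hs'⟩
      · exact ⟨a + 1, b, h, by omega, by split_ifs at hab ⊢ <;> omega, hs'⟩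
      · exact ⟨a, b + 1, ha, h, by split_ifs at hab ⊢ <;> omega, hs'⟩


/-- **Proposition 4.7 (Prop:VANew), combinatorial encoding.** Fix `ℓ ∈ {1, ..., 13}`
and a function `inc` from `{1, ..., 13} \ {ℓ}` to `{0, ..., 5}` attaining every value
exactly twice.  Define slope vectors `s k : Fin 6 → ℤ` by `s 0 i = i - 2` and, for
`k ≥ 1`, `s k i = s (k-1) i + 1` if `k ≠ ℓ` and `inc k = i`, and `s k i = s (k-1) i`
otherwise; assume each `s k` is strictly increasing.  With `z₁ = min 6 ℓ`,
`z₂ = max 7 ℓ`, and `σ k = 4, 3, 2` on the three blocks, loop `k` admits no new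
permissible pair `(i, j)` (i.e. no `i ≤ j` with `s (k-1) i + s (k-1) j ≤ σ k - 1`
and `s k i + s k j ≥ σ k`) if and only if `k = ℓ`, or `ℓ > 6` and `k = 6`, or
`ℓ > 7` and `k = 7`, or `ℓ < 9` and `k = 9`, or `ℓ ≤ 7`, `s 7 5 = 4` and `k = 8`. -/
theorem stmt_4 (ℓ : ℕ) (hℓ1 : 1 ≤ ℓ) (hℓ13 : ℓ ≤ 13)
    (inc : ℕ → Fin 6)
    (hinc : ∀ v : Fin 6,
      (((Finset.Icc 1 13).erase ℓ).filter (fun k => inc k = v)).card = 2)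
    (s : ℕ → Fin 6 → ℤ)
    (hs0 : ∀ i : Fin 6, s 0 i = ((i : ℕ) : ℤ) - 2)
    (hstep : ∀ k, 1 ≤ k → k ≤ 13 → ∀ i : Fin 6,
      s k i = s (k - 1) i + (if k ≠ ℓ ∧ inc k = i then 1 else 0))
    (hmono : ∀ k, k ≤ 13 → StrictMono (s k)) :
    ∀ k, 1 ≤ k → k ≤ 13 →
      ((¬ ∃ i j : Fin 6, i ≤ j ∧
          s (k - 1) i + s (k - 1) j ≤
            (if k ≤ min 6 ℓ then (4 : ℤ) else if k ≤ max 7 ℓ then 3 else 2) - 1 ∧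
          (if k ≤ min 6 ℓ then (4 : ℤ) else if k ≤ max 7 ℓ then 3 else 2) ≤
            s k i + s k j) ↔
        (k = ℓ ∨ (6 < ℓ ∧ k = 6) ∨ (7 < ℓ ∧ k = 7) ∨ (ℓ < 9 ∧ k = 9) ∨
          (ℓ ≤ 7 ∧ s 7 5 = 4 ∧ k = 8))) := by
  intro k hk1 hk13
  obtain ⟨k, rfl⟩ : ∃ m, k = m + 1 := ⟨k - 1, by omega⟩
  rw [Nat.add_sub_cancel]
  by_cases hkℓ : k + 1 = ℓ
  · have heq (i : Fin 6) : s (k + 1) i = s k i := by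
      rw [hstep (k + 1) hk1 hk13 i, if_neg (by simp [hkℓ]), Nat.add_sub_cancel, add_zero]
    refine iff_of_true ?_ (Or.inl hkℓ)
    rintro ⟨i, j, -, h1, h2⟩
    rw [heq, heq] at h2
    omega
  · obtain ⟨a, b, ha, hb, hab, hs⟩ :=
      exists_eq_diagramSlope ℓ hℓ1 inc hinc s hs0 hstep hmono k (by omega)
    have hk : nextLoop ℓ (a + b) = k + 1 := by
      unfold nextLoop
      split_ifs at hab ⊢ <;> omega
    have hmain := not_hasNewPair_diagramSlope_iff ℓ (by omega) a ha b (by omega)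
    simp only [hk] at hmain
    have hpair : ¬ HasNewPair (blockSlope ℓ (k + 1)) (s k) (s (k + 1)) ↔
        IsExceptional ℓ (k + 1) (s k) := by
      rcases diagramSlope_step ℓ inc hinc s hs0 hstep hmono k hk13 hkℓ a b ha hb hs with
        ⟨h, hs'⟩ | ⟨h, hs'⟩
      · rw [hs, hs']
        exact hmain.1 h
      · rw [hs, hs']
        exact hmain.2 h
    have hlast : (ℓ ≤ 7 ∧ s k 5 = 4 ∧ k + 1 = 8) ↔ (ℓ ≤ 7 ∧ s 7 5 = 4 ∧ k + 1 = 8) := by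
      constructor <;>
      · rintro ⟨h1, h2, h3⟩
        obtain rfl : k = 7 := by omega
        exact ⟨h1, h2, h3⟩
    rw [← hlast, or_iff_right hkℓ]
    exact hpair
end

section
/- Let R = ℚ[α, β, γ] be the polynomial ring in three variables over ℚ, and let S = R[h]/(h² − αh + (α² − β)/4), a free R-module with basis {1, h}. Define c_n ∈ S for n ≥ 0 by c_0 = 2, c_1 = h, c_2 = h²/2, c_3 = (1/3)(h³/2 + βh/4 − γ/2), c_4 = (1/4)(h⁴/6 + βh²/3 − 2γh/3), and for n ≥ 1 by the recursion (n+4)c_{n+4} − ((n+2)/2)·β·c_{n+2} + (β/4)²·n·c_n = h·c_{n+3} − (βh/4 + γ/2)·c_{n+1}. Let D ∈ S be the determinant of the 8×8 matrix with rows (c_8, c_9, c_10, c_11, c_12, c_13, c_14, c_15), (c_6, c_7, c_8, c_9, c_10, c_11, c_12, c_13), (c_4, c_5, c_6, c_7, c_8, c_9, c_10, c_11), (c_2, c_3, c_4, c_5, c_6, c_7, c_8, c_9), (c_0, c_1, c_2, c_3, c_4, c_5, c_6, c_7), (0, 0, c_0, c_1, c_2, c_3, c_4, c_5), (0, 0,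 0, 0, c_0, c_1, c_2, c_3), (0, 0, 0, 0, 0, 0, c_0, c_1), and write D = f + u·h with f, u ∈ R (possible uniquely, since S is free over R with basis {1, h}). Let Λ : R → ℚ be the ℚ-linear map defined on monomials by Λ(α^m β^n γ^p) = (−1)^{13−p} · (13!·m!)/((13−p)!·q!) · 2^{24−p} · (2^q − 2) · B_q if m + 2n + 3p = 36 and q := m + p − 12 ≥ 0, and Λ(α^m β^n γ^p) = 0 otherwise, where B_q is the q-th Bernoulli number. Then Λ(f) = −6. -/
noncomputable section

open scoped BigOperators

/-- The base ring `R = ℚ[α, β, γ]`. -/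
abbrev NabRing : Type := MvPolynomial (Fin 3) ℚ

/-- The tautological class `α`. -/
def nabα : NabRing := MvPolynomial.X 0

/-- The tautological class `β`. -/
def nabβ : NabRing := MvPolynomial.X 1

/-- The tautological class `γ`. -/
def nabγ : NabRing := MvPolynomial.X 2

/-- The defining relation `h² - αh + (α² - β)/4` of the Hecke correspondence. -/
def nabRel : Polynomial NabRing :=
  Polynomial.X ^ 2 - Polynomial.C nabα * Polynomial.X
    + Polynomial.C (MvPolynomial.C (1/4 : ℚ) * (nabα ^ 2 - nabβ))

/-- The ring `S = R[h]/(h² - αh + (α² - β)/4)`. -/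
abbrev NabS : Type := Polynomial NabRing ⧸ Ideal.span {nabRel}

/-- The structure map `R → S`. -/
def nabι : NabRing →+* NabS :=
  (Ideal.Quotient.mk (Ideal.span {nabRel})).comp Polynomial.C

/-- The class `h ∈ S`. -/
def nabH : NabS := Ideal.Quotient.mk (Ideal.span {nabRel}) Polynomial.X

/-- Rational constants in `S`. -/
def nabQ (x : ℚ) : NabS := nabι (MvPolynomial.C x)

/-- A polynomial in three variables, as a list of terms `(v, k, n, p)` standing for
`v * x ^ k * y ^ n * z ^ p`. -/
abbrev TermList : Type := List (ℤ × ℕ × ℕ × ℕ)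

/-- The value of a term list at `(x, y, z)`. -/
def TermList.eval {A : Type*} [CommRing A] (x y z : A) (l : TermList) : A :=
  (l.map fun (v, k, n, p) => (v : A) * x ^ k * y ^ n * z ^ p).sum

/-- The classes `n! * c n`, as polynomials in `h`, `β / 4` and `γ / 2`. -/
def chernTerms : ℕ → TermList
  | 0 =>
    [(2, 0, 0, 0)]
  | 1 =>
    [(1, 1, 0, 0)]
  | 2 =>
    [(1, 2, 0, 0)]
  | 3 =>
    [(1, 3, 0, 0), (2, 1, 1, 0), (-2, 0, 0, 1)]
  | 4 =>
    [(1, 4, 0, 0), (8, 2, 1, 0), (-8, 1, 0, 1)]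
  | 5 =>
    [(1, 5, 0, 0), (20, 3, 1, 0), (24, 1, 2, 0), (-20, 2, 0, 1), (-48, 0, 1, 1)]
  | 6 =>
    [(1, 6, 0, 0), (40, 4, 1, 0), (184, 2, 2, 0), (-40, 3, 0, 1), (-368, 1, 1, 1), (40, 0, 0, 2)]
  | 7 =>
    [(1, 7, 0, 0), (70, 5, 1, 0), (784, 3, 2, 0), (720, 1, 3, 0), (-70, 4, 0, 1),
     (-1568, 2, 1, 1), (-2160, 0, 2, 1), (280, 1, 0, 2)]
  | 8 =>
    [(1, 8, 0, 0), (112, 6, 1, 0), (2464, 4, 2, 0), (8448, 2, 3, 0), (-112, 5, 0, 1),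
     (-4928, 3, 1, 1), (-25344, 1, 2, 1), (1120, 2, 0, 2), (5376, 0, 1, 2)]
  | 9 =>
    [(1, 9, 0, 0), (168, 7, 1, 0), (6384, 5, 2, 0), (52352, 3, 3, 0), (40320, 1, 4, 0),
     (-168, 6, 0, 1), (-12768, 4, 1, 1), (-157056, 2, 2, 1), (-161280, 0, 3, 1), (3360, 3, 0, 2),
     (55104, 1, 1, 2), (-2240, 0, 0, 3)]
  | 10 =>
    [(1, 10, 0, 0), (240, 8, 1, 0), (14448, 6, 2, 0), (229760, 4, 3, 0), (648576, 2, 4, 0),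
     (-240, 7, 0, 1), (-28896, 5, 1, 1), (-689280, 3, 2, 1), (-2594304, 1, 3, 1), (8400, 4, 0, 2),
     (309120, 2, 1, 2), (808704, 0, 2, 2), (-22400, 1, 0, 3)]
  | 11 =>
    [(1, 11, 0, 0), (330, 9, 1, 0), (29568, 7, 2, 0), (804320, 5, 3, 0), (5360256, 3, 4, 0),
     (3628800, 1, 5, 0), (-330, 8, 0, 1), (-59136, 6, 1, 1), (-2412960, 4, 2, 1),
     (-21441024, 2, 3, 1), (-18144000, 0, 4, 1), (18480, 5, 0, 2), (1256640, 3, 1, 2),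
     (11113344, 1, 2, 2), (-123200, 2, 0, 3), (-887040, 0, 1, 3)]
  | 12 =>
    [(1, 12, 0, 0), (440, 10, 1, 0), (55968, 8, 2, 0), (2393600, 6, 3, 0), (30633856, 4, 4, 0),
     (74972160, 2, 5, 0), (-440, 9, 0, 1), (-111936, 7, 1, 1), (-7180800, 5, 2, 1),
     (-122535424, 3, 3, 1), (-374860800, 1, 4, 1), (36960, 6, 0, 2), (4139520, 4, 1, 2),
     (81464064, 2, 2, 2), (153077760, 0, 3, 2), (-492800, 3, 0, 3), (-11630080, 1, 1, 3),
     (246400, 0, 0, 4)]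
  | 13 =>
    [(1, 13, 0, 0), (572, 11, 1, 0), (99528, 9, 2, 0), (6296576, 7, 3, 0), (136804096, 5, 4, 0),
     (782525952, 3, 5, 0), (479001600, 1, 6, 0), (-572, 10, 0, 1), (-199056, 8, 1, 1),
     (-18889728, 6, 2, 1), (-547216384, 4, 3, 1), (-3912629760, 2, 4, 1), (-2874009600, 0, 5, 1),
     (68640, 7, 0, 2), (11723712, 5, 1, 2), (423481344, 3, 2, 2), (2668064256, 1, 3, 2),
     (-1601600, 4, 0, 3), (-82001920, 2, 1, 3), (-314316288, 0, 2, 3), (3203200, 1, 0, 4)]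
  | 14 =>
    [(1, 14, 0, 0), (728, 12, 1, 0), (168168, 10, 2, 0), (15027584, 8, 3, 0),
     (510205696, 6, 4, 0), (5561407488, 4, 5, 0), (12174658560, 2, 6, 0), (-728, 11, 0, 1),
     (-336336, 9, 1, 1), (-45082752, 7, 2, 1), (-2040822784, 5, 3, 1), (-27807037440, 3, 4, 1),
     (-73047951360, 1, 5, 1), (120120, 8, 0, 2), (29597568, 6, 1, 2), (1751253504, 4, 2, 2),
     (24391471104, 2, 3, 2), (36713364480, 0, 4, 2), (-4484480, 5, 0, 3), (-412572160, 3, 1, 3),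
     (-5153820672, 1, 2, 3), (22422400, 2, 0, 4), (215255040, 0, 1, 4)]
  | 15 =>
    [(1, 15, 0, 0), (910, 13, 1, 0), (272272, 11, 2, 0), (33141680, 9, 3, 0),
     (1656182528, 7, 4, 0), (30459752960, 5, 5, 0), (154594381824, 3, 6, 0),
     (87178291200, 1, 7, 0), (-910, 12, 0, 1), (-544544, 10, 1, 1), (-99425040, 8, 2, 1),
     (-6624730112, 6, 3, 1), (-152298764800, 4, 4, 1), (-927566290944, 2, 5, 1),
     (-610248038400, 0, 6, 1), (200200, 9, 0, 2), (68228160, 7, 1, 2), (6128234112, 5, 2, 2),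
     (155824148480, 3, 3, 2), (781266290688, 1, 4, 2), (-11211200, 6, 0, 3),
     (-1659257600, 4, 1, 3), (-44752547840, 2, 2, 3), (-120961032192, 0, 3, 3),
     (112112000, 3, 0, 4), (3453049600, 1, 1, 4), (-44844800, 0, 0, 5)]
  | _ => []

/-- The coefficients of `16! * (∑ c (2 * k + 1) * x ^ k) / (∑ c (2 * k) * x ^ k)`, as polynomials in `h`,
`β / 4` and `γ / 2`. -/
def quotTerms : ℕ → TermList
  | 0 =>
    [(10461394944000, 1, 0, 0)]
  | 1 =>
    [(-871782912000, 3, 0, 0), (3487131648000, 1, 1, 0), (-3487131648000, 0, 0, 1)]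
  | 2 =>
    [(87178291200, 5, 0, 0), (-871782912000, 3, 1, 0), (2092278988800, 1, 2, 0),
     (871782912000, 2, 0, 1), (-4184557977600, 0, 1, 1)]
  | 3 =>
    [(-8821612800, 7, 0, 0), (145297152000, 5, 1, 0), (-813664051200, 3, 2, 0),
     (1494484992000, 1, 3, 0), (-145297152000, 4, 0, 1), (1627328102400, 2, 1, 1),
     (-4483454976000, 0, 2, 1), (-290594304000, 1, 0, 2)]
  | 4 =>
    [(893692800, 9, 0, 0), (-20583763200, 7, 1, 0), (184043059200, 5, 2, 0),
     (-754622668800, 3, 3, 0), (1162377216000, 1, 4, 0), (20583763200, 6, 0, 1),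
     (-368086118400, 4, 1, 1), (2263868006400, 2, 2, 1), (-4649508864000, 0, 3, 1),
     (96864768000, 3, 0, 2), (-794291097600, 1, 1, 2), (32288256000, 0, 0, 3)]
  | 5 =>
    [(-90548640, 11, 0, 0), (2681078400, 9, 1, 0), (-32934021120, 7, 2, 0),
     (210796185600, 5, 3, 0), (-702407946240, 3, 4, 0), (951035904000, 1, 5, 0),
     (-2681078400, 8, 0, 1), (65868042240, 6, 1, 1), (-632388556800, 4, 2, 1),
     (2809631784960, 2, 3, 1), (-4755179520000, 0, 4, 1), (-20583763200, 5, 0, 2),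
     (329340211200, 3, 1, 2), (-1456292597760, 1, 2, 2), (-32288256000, 2, 0, 3),
     (116237721600, 0, 1, 3)]
  | 6 =>
    [(9174480, 13, 0, 0), (-332011680, 11, 1, 0), (5183418240, 9, 2, 0), (-44957552640, 7, 3, 0),
     (229830881280, 5, 4, 0), (-657321799680, 3, 5, 0), (804722688000, 1, 6, 0),
     (332011680, 10, 0, 1), (-10366836480, 8, 1, 1), (134872657920, 6, 2, 1),
     (-919323525120, 4, 3, 1), (3286608998400, 2, 4, 1), (-4828336128000, 0, 5, 1),
     (3574771200, 7, 0, 2), (-83707303680, 5, 1, 2), (711448657920, 3, 2, 2),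
     (-2241173975040, 1, 3, 2), (11435424000, 4, 0, 3), (-137763225600, 2, 1, 3),
     (264025681920, 0, 2, 3), (5381376000, 1, 0, 4)]
  | 7 =>
    [(-929569, 15, 0, 0), (39756080, 13, 1, 0), (-752559808, 11, 2, 0), (8219136640, 9, 3, 0),
     (-56310205952, 7, 4, 0), (243678023680, 5, 5, 0), (-618377527296, 3, 6, 0),
     (697426329600, 1, 7, 0), (-39756080, 12, 0, 1), (1505119616, 10, 1, 1),
     (-24657409920, 8, 2, 1), (225240823808, 6, 3, 1), (-1218390118400, 4, 4, 1),
     (3710265163776, 2, 5, 1), (-4881984307200, 0, 6, 1), (-553352800, 9, 0, 2),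
     (16920583680, 7, 1, 2), (-208359959808, 5, 2, 2), (1246593187840, 3, 3, 2),
     (-3125065162752, 1, 4, 2), (-2780377600, 6, 0, 3), (56414758400, 4, 1, 3),
     (-358020382720, 2, 2, 3), (483844128768, 0, 3, 3), (-3811808000, 3, 0, 4),
     (27624396800, 1, 1, 4), (-358758400, 0, 0, 5)]
  | _ => []

/-- The primitive part of the Hankel determinant of the entries `quotTerms 1, …, quotTerms 7`. -/
def hankelTerms : TermList :=
  [(1, 36, 0, 0), (-840, 34, 1, 0), (306768, 32, 2, 0), (-64514560, 30, 3, 0),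
   (8721732096, 28, 4, 0), (-801168076800, 26, 5, 0), (51537806499840, 24, 6, 0),
   (-2358301291315200, 22, 7, 0), (77200674303836160, 20, 8, 0), (-1803995907004825600, 18, 9, 0),
   (29809686748257583104, 16, 10, 0), (-342516141518707752960, 14, 11, 0),
   (2668017266285432799232, 12, 12, 0), (-13587026399509862154240, 10, 13, 0),
   (42844889488747527143424, 8, 14, 0), (-75454304094597729484800, 6, 15, 0),
   (56556942992332554240000, 4, 16, 0), (840, 33, 0, 1), (-613536, 31, 1, 1),
   (193543680, 29, 2, 1), (-34886928384, 27, 3, 1), (4005840384000, 25, 4, 1),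
   (-309226838999040, 23, 5, 1), (16508109039206400, 21, 6, 1), (-617605394430689280, 19, 7, 1),
   (16235963163043430400, 17, 8, 1), (-298096867482575831040, 15, 9, 1),
   (3767677556705785282560, 13, 10, 1), (-32016207195425193590784, 11, 11, 1),
   (176631343193628208005120, 9, 12, 1), (-599828452842465380007936, 7, 13, 1),
   (1131814561418965942272000, 5, 14, 1), (-904911087877320867840000, 3, 15, 1),
   (240240, 30, 0, 2), (-147544320, 28, 1, 2), (38616044544, 26, 2, 2),
   (-5680888012800, 24, 3, 2), (521592030535680, 22, 4, 2), (-31370171586969600, 20, 5, 2),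
   (1261234062042071040, 18, 6, 2), (-33938755670192947200, 16, 7, 2),
   (601219410287536373760, 14, 8, 2), (-6739199875639934976000, 12, 9, 2),
   (44015910116294897172480, 10, 10, 2), (-135752228217617991598080, 8, 11, 2),
   (14967004774150497632256, 6, 12, 2), (885560413579062018048000, 4, 13, 2),
   (-1442202046304480133120000, 2, 14, 2), (32771200, 27, 0, 3), (-16789893120, 25, 1, 3),
   (3638425190400, 23, 2, 3), (-440660769669120, 21, 3, 3), (33231515885568000, 19, 4, 3),
   (-1646990465048248320, 17, 5, 3), (55189208129706393600, 15, 6, 3),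
   (-1263950234199911301120, 13, 7, 3), (19608625509120029491200, 11, 8, 3),
   (-198476500023825368350720, 9, 9, 3), (1214590704149081987481600, 7, 10, 3),
   (-3930491292465189460377600, 5, 11, 3), (5248160085149906632704000, 3, 12, 3),
   (-735240258900323205120000, 1, 13, 3), (2018016000, 24, 0, 4), (-766846080000, 22, 1, 4),
   (113441558630400, 20, 2, 4), (-7983387533721600, 18, 3, 4), (227608907070504960, 16, 4, 4),
   (3079327955661619200, 14, 5, 4), (-389849379323149025280, 12, 6, 4),
   (10378224483152324198400, 10, 7, 4), (-119243869501012228177920, 8, 8, 4),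
   (556178613460392738816000, 6, 9, 4), (-587469418982713495388160, 4, 10, 4),
   (-1156678605864104361984000, 2, 11, 4), (-123718312795727462400000, 0, 12, 4),
   (124309785600, 21, 0, 5), (-49723914240000, 19, 1, 5), (8301620584857600, 17, 2, 5),
   (-727523943668121600, 15, 3, 5), (34359456801993523200, 13, 4, 5),
   (-812582776693774614528, 11, 5, 5), (7074738703654579077120, 9, 6, 5),
   (36128779449224612806656, 7, 7, 5), (-882386190367715984670720, 5, 8, 5),
   (4042657682367912892956672, 3, 9, 5), (-5017858195398167258726400, 1, 10, 5),
   (-6629855232000, 18, 0, 6), (2193819096268800, 16, 1, 6), (-169021529284608000, 14, 2, 6),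
   (-2486906432480870400, 12, 3, 6), (650820013135862169600, 10, 4, 6),
   (-22628682846311358136320, 8, 5, 6), (308795890667593188507648, 6, 6, 6),
   (-1774302608174642091786240, 4, 7, 6), (3710807324304291819159552, 2, 8, 6),
   (-1582538782892189810688000, 0, 9, 6), (407736096768000, 15, 0, 7),
   (134214789316608000, 13, 1, 7), (-22253909972720025600, 11, 2, 7),
   (1033926453818818560000, 9, 3, 7), (-20095843341400591564800, 7, 4, 7),
   (190287855580686141358080, 5, 5, 7), (-964748122832834805104640, 3, 6, 7),
   (1684448237950216697806848, 1, 7, 7), (126696533483520000, 12, 0, 8),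
   (-10193641093988352000, 10, 1, 8), (266763946843570176000, 8, 2, 8),
   (-4797637180885617868800, 6, 3, 8), (84305515780711120896000, 4, 4, 8),
   (-549956350608910634188800, 2, 5, 8), (328656101904913646223360, 0, 6, 8),
   (1769729356595200000, 9, 0, 9), (-27607777962885120000, 7, 1, 9),
   (-2776917728020660224000, 5, 2, 9), (68000647111208075264000, 3, 3, 9),
   (-200705432537451095654400, 1, 4, 9), (37164316488499200000, 6, 0, 10),
   (-2527173521217945600000, 4, 1, 10), (24957431278448148480000, 2, 2, 10),
   (1549433446286229504000, 0, 3, 10), (-743286329769984000000, 3, 0, 11),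
   (1189258127631974400000, 1, 1, 11), (-991048439693312000000, 0, 0, 12)]

section Determinants

variable {A : Type*} [CommRing A]

/-- Laplace expansion along a column whose only nonzero entry is a `1`. -/
theorem det_eq_of_column_eq_single {n : ℕ} (M : Matrix (Fin (n + 1)) (Fin (n + 1)) A)
    (i j : Fin (n + 1)) (h1 : M i j = 1) (h0 : ∀ k, k ≠ i → M k j = 0) :
    M.det = (-1) ^ (i + j : ℕ) * (M.submatrix i.succAbove j.succAbove).det := by
  rw [Matrix.det_succ_column M j,
    Finset.sum_eq_single i (fun k _ hk => by simp [h0 k hk]) (by simp), h1, mul_one]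

theorem det_interleaved_hankel (y : ℕ → A) :
    Matrix.det
      !![0, y 4, 0, y 5, 0, y 6, 0, y 7;
         0, y 3, 0, y 4, 0, y 5, 0, y 6;
         0, y 2, 0, y 3, 0, y 4, 0, y 5;
         0, y 1, 0, y 2, 0, y 3, 0, y 4;
         1, y 0, 0, y 1, 0, y 2, 0, y 3;
         0, 0,   1, y 0, 0, y 1, 0, y 2;
         0, 0,   0, 0,   1, y 0, 0, y 1;
         0, 0,   0, 0,   0, 0,   1, y 0] =
    Matrix.det
      !![y 4, y 5, y 6, y 7;
         y 3, y 4, y 5, y 6;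
         y 2, y 3, y 4, y 5;
         y 1, y 2, y 3, y 4] := by
  rw [det_eq_of_column_eq_single _ 7 6 rfl
      (by intro k hk; fin_cases k <;> first | rfl | exact absurd rfl hk),
    det_eq_of_column_eq_single _ 6 4 rfl
      (by intro k hk; fin_cases k <;> first | rfl | exact absurd rfl hk),
    det_eq_of_column_eq_single _ 5 2 rfl
      (by intro k hk; fin_cases k <;> first | rfl | exact absurd rfl hk),
    det_eq_of_column_eq_single _ 4 0 rfl
      (by intro k hk; fin_cases k <;> first | rfl | exact absurd rfl hk)]
  have h : (-1 : A) ^ ((7 : Fin 8) + (6 : Fin 8) : ℕ) *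
      ((-1) ^ ((6 : Fin 7) + (4 : Fin 7) : ℕ) * ((-1) ^ ((5 : Fin 6) + (2 : Fin 6) : ℕ) *
        (-1) ^ ((4 : Fin 5) + (0 : Fin 5) : ℕ))) = 1 := by
    simp; norm_num
  simp only [← mul_assoc] at h ⊢
  rw [h, one_mul]
  congr 1
  ext i j
  fin_cases i <;> fin_cases j <;> rfl

/-- The degeneracy-locus determinant is a Hankel determinant in the coefficients `y` of the
quotient of the odd part by the even part of the generating series of `c`. -/
theorem det_mul_pow_eq_hankel (c y : ℕ → A) (K : A)
    (hy : ∀ k < 8, ∑ l ∈ Finset.range (k + 1), c (2 * (k - l)) * y l = c (2 * k + 1) * K) :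
    Matrix.det
      !![c 8, c 9, c 10, c 11, c 12, c 13, c 14, c 15;
         c 6, c 7, c 8,  c 9,  c 10, c 11, c 12, c 13;
         c 4, c 5, c 6,  c 7,  c 8,  c 9,  c 10, c 11;
         c 2, c 3, c 4,  c 5,  c 6,  c 7,  c 8,  c 9;
         c 0, c 1, c 2,  c 3,  c 4,  c 5,  c 6,  c 7;
         0,   0,   c 0,  c 1,  c 2,  c 3,  c 4,  c 5;
         0,   0,   0,    0,    c 0,  c 1,  c 2,  c 3;
         0,   0,   0,    0,    0,    0,    c 0,  c 1] * K ^ 4 =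
    c 0 ^ 8 * Matrix.det
      !![y 4, y 5, y 6, y 7;
         y 3, y 4, y 5, y 6;
         y 2, y 3, y 4, y 5;
         y 1, y 2, y 3, y 4] := by
  have h0 := hy 0 (by norm_num)
  have h1 := hy 1 (by norm_num)
  have h2 := hy 2 (by norm_num)
  have h3 := hy 3 (by norm_num)
  have h4 := hy 4 (by norm_num)
  have h5 := hy 5 (by norm_num)
  have h6 := hy 6 (by norm_num)
  have h7 := hy 7 (by norm_num)
  simp only [Finset.sum_range_succ, Finset.sum_range_zero, zero_add, Nat.reduceMul,
    Nat.reduceSub, Nat.reduceAdd] at h0 h1 h2 h3 h4 h5 h6 h7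
  have hE : Matrix.det
      !![c 0, c 2, c 4, c 6, c 8, c 10, c 12, c 14;
         0,   c 0, c 2, c 4, c 6, c 8,  c 10, c 12;
         0,   0,   c 0, c 2, c 4, c 6,  c 8,  c 10;
         0,   0,   0,   c 0, c 2, c 4,  c 6,  c 8;
         0,   0,   0,   0,   c 0, c 2,  c 4,  c 6;
         0,   0,   0,   0,   0,   c 0,  c 2,  c 4;
         0,   0,   0,   0,   0,   0,    c 0,  c 2;
         0,   0,   0,   0,   0,   0,    0,    c 0] = c 0 ^ 8 := by
    rw [Matrix.det_of_isUpperTriangular]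
    · simp [Fin.prod_univ_succ]; ring
    · intro i j hij
      fin_cases i <;> fin_cases j <;> first | rfl | exact absurd hij (by decide)
  have hK : Matrix.det (Matrix.diagonal ![1, K, 1, K, 1, K, 1, K]) = K ^ 4 := by
    simp [Matrix.det_diagonal, Fin.prod_univ_succ]; ring
  rw [← det_interleaved_hankel, ← hE, ← hK, ← Matrix.det_mul, ← Matrix.det_mul]
  congr 1
  ext i j
  rw [Matrix.mul_diagonal, Matrix.mul_apply]
  fin_cases i <;> fin_cases j <;>
    simp [Fin.sum_univ_succ, ← h0, ← h1, ← h2, ← h3, ← h4, ← h5, ← h6, ← h7] <;> try ring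

theorem det_hankel_four (y : ℕ → A) :
    Matrix.det
      !![y 4, y 5, y 6, y 7;
         y 3, y 4, y 5, y 6;
         y 2, y 3, y 4, y 5;
         y 1, y 2, y 3, y 4] =
      (y 1 * y 3 - y 2 * y 2) * (y 5 * y 7 - y 6 * y 6)
      - (y 1 * y 4 - y 3 * y 2) * (y 4 * y 7 - y 6 * y 5)
      + (y 1 * y 5 - y 4 * y 2) * (y 4 * y 6 - y 5 * y 5)
      + (y 2 * y 4 - y 3 * y 3) * (y 3 * y 7 - y 6 * y 4)
      - (y 2 * y 5 - y 4 * y 3) * (y 3 * y 6 - y 5 * y 4)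
      + (y 3 * y 5 - y 4 * y 4) * (y 3 * y 5 - y 4 * y 4) := by
  rw [Matrix.det_succ_row_zero]
  simp [Fin.sum_univ_succ, Matrix.det_fin_three, Fin.succAbove]
  ring

set_option maxHeartbeats 4000000 in
theorem det_hankel_quotTerms (h b g : A) (y : ℕ → A)
    (hy : ∀ n, y n = (quotTerms n).eval h b g) :
    Matrix.det
      !![y 4, y 5, y 6, y 7;
         y 3, y 4, y 5, y 6;
         y 2, y 3, y 4, y 5;
         y 1, y 2, y 3, y 4] = 219337790953881600000 * hankelTerms.eval h b g := by
  rw [det_hankel_four]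
  simp only [hy, quotTerms, hankelTerms, TermList.eval, List.map_cons, List.map_nil,
    List.sum_cons, List.sum_nil]
  push_cast
  ring

end Determinants

section Recursion

variable {A : Type*} [CommRing A]

theorem factorial_mul_chern {c : ℕ → A} {h b g : A} (h0 : c 0 = 2) (h1 : c 1 = h)
    (h2 : 2 * c 2 = h ^ 2) (h3 : 6 * c 3 = h ^ 3 + 2 * h * b - 2 * g)
    (h4 : 24 * c 4 = h ^ 4 + 8 * h ^ 2 * b - 8 * h * g)
    (hrec : ∀ n : ℕ, 1 ≤ n → ((n : A) + 4) * c (n + 4) = 2 * ((n : A) + 2) * b * c (n + 2)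
      - n * b ^ 2 * c n + h * c (n + 3) - (b * h + g) * c (n + 1)) (n : ℕ) (hn : n < 16) :
    (n.factorial : A) * c n = (chernTerms n).eval h b g := by
  have step (n : ℕ) (hn : 1 ≤ n) : ((n + 4).factorial : A) * c (n + 4) =
      2 * (n + 2) * (n + 3) * b * ((n + 2).factorial * c (n + 2))
      - n * (n + 1) * (n + 2) * (n + 3) * b ^ 2 * (n.factorial * c n)
      + h * ((n + 3).factorial * c (n + 3))
      - (n + 2) * (n + 3) * (b * h + g) * ((n + 1).factorial * c (n + 1)) := by
    simp only [Nat.factorial_succ]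
    push_cast
    linear_combination (n + 3) * (n + 2) * (n + 1) * (n.factorial : A) * hrec n hn
  induction n using Nat.strong_induction_on with
  | _ n ih =>
    obtain hn5 | ⟨m, rfl⟩ : n < 5 ∨ ∃ m, n = m + 1 + 4 := by
      rcases lt_or_ge n 5 with h | h
      · exact .inl h
      · exact .inr ⟨n - 5, by omega⟩
    · interval_cases n <;> simp [Nat.factorial, chernTerms, TermList.eval, *] <;> ring
    · rw [step (m + 1) (by omega), ih _ (by omega) (by omega), ih _ (by omega) (by omega),
        ih _ (by omega) (by omega), ih _ (by omega) (by omega)]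
      have hm : m < 11 := by omega
      clear step ih hn
      interval_cases m <;> simp [chernTerms, TermList.eval] <;> ring

theorem sum_mul_quotTerms (q : ℚ →+* A) {c : ℕ → A} {h b g : A}
    (e : ∀ n < 16, (n.factorial : A) * c n = (chernTerms n).eval h b g) (k : ℕ) (hk : k < 8) :
    ∑ l ∈ Finset.range (k + 1), c (2 * (k - l)) * (quotTerms l).eval h b g =
      c (2 * k + 1) * 20922789888000 := by
  have hu : IsUnit ((2 * k + 1).factorial : A) := by
    simpa using (isUnit_iff_ne_zero.2 (Nat.cast_ne_zero.2 (2 * k + 1).factorial_ne_zero :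
      ((2 * k + 1).factorial : ℚ) ≠ 0)).map q
  have key (i j) (hij : i + j = 2 * k + 1) (hj : j < 16) : ((2 * k + 1).factorial : A) * c j =
      ((2 * k + 1).descFactorial i : A) * (chernTerms j).eval h b g := by
    rw [← e j hj, ← mul_assoc, ← Nat.cast_mul, mul_comm (Nat.descFactorial _ _),
      show j = 2 * k + 1 - i by omega, Nat.factorial_mul_descFactorial (by omega)]
  apply hu.mul_left_cancel
  rw [Finset.mul_sum, ← mul_assoc, key 0 _ (by omega) (by omega),
    Finset.sum_congr rfl fun l hl => by
      rw [← mul_assoc, key (2 * l + 1) (2 * (k - l))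
        (by have := Finset.mem_range.1 hl; omega) (by omega)]]
  clear key hu e
  interval_cases k <;>
    simp [Finset.sum_range_succ, Nat.descFactorial, chernTerms, quotTerms, TermList.eval] <;> ring

end Recursion

section Integrals

/-- The Bernoulli numbers `B_q` for `q ≤ 24`. -/
def bernoulliValue : ℕ → ℚ
  | 0 => 1
  | 1 => -1 / 2
  | 2 => 1 / 6
  | 4 => -1 / 30
  | 6 => 1 / 42
  | 8 => -1 / 30
  | 10 => 5 / 66
  | 12 => -691 / 2730
  | 14 => 7 / 6
  | 16 => -3617 / 510
  | 18 => 43867 / 798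
  | 20 => -174611 / 330
  | 22 => 854513 / 138
  | 24 => -236364091 / 2730
  | _ => 0

theorem bernoulli_eq_bernoulliValue (q : ℕ) (hq : q ≤ 24) : bernoulli q = bernoulliValue q := by
  induction q using Nat.strong_induction_on with
  | _ q ih =>
    have h := sum_bernoulli (q + 1)
    rw [Finset.sum_range_succ, Finset.sum_congr rfl fun k hk => by
      rw [ih k (Finset.mem_range.1 hk) (by have := Finset.mem_range.1 hk; omega)]] at h
    have hv : ∑ k ∈ Finset.range q, ((q + 1).choose k : ℚ) * bernoulliValue k +
        ((q + 1).choose q : ℚ) * bernoulliValue q = if q + 1 = 1 then 1 else 0 := by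
      clear h ih
      interval_cases q <;> decide +kernel
    have hc : ((q + 1).choose q : ℚ) ≠ 0 := by simp; positivity
    exact mul_left_cancel₀ hc (by linear_combination h - hv)

/-- Thaddeus' formula for the integral of `α ^ m * β ^ n * γ ^ p`. -/
def thaddeus (m n p : ℕ) : ℚ :=
  if m + 2 * n + 3 * p = 36 ∧ 12 ≤ m + p then
    (-1 : ℚ) ^ (13 - p) *
      ((Nat.factorial 13 : ℚ) * (Nat.factorial m : ℚ)) /
        ((Nat.factorial (13 - p) : ℚ) * (Nat.factorial (m + p - 12) : ℚ)) *
      2 ^ (24 - p) * (2 ^ (m + p - 12) - 2) * bernoulliValue (m + p - 12)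
  else 0

/-- The integral of `h ^ k * (β / 4) ^ n * (γ / 2) ^ p`, i.e. of its coefficient at `1` with respect
to the basis `{1, h}`. -/
def heckeIntegral (k n p : ℕ) : ℚ :=
  ∑ j ∈ Finset.range (k + 1),
    (-1) ^ j * k.choose j / 2 ^ (k - j + j % 2 + 2 * (n + j / 2) + p) *
      thaddeus (k - j + j % 2) (n + j / 2) p

/-- A ring over `R` generated by `h` with `(h - α / 2) ^ 2 = β / 4`, together with the coefficient
at `1` with respect to the basis `{1, h}`; here `a = α / 2`, `b = β / 4` and `g = γ / 2`. -/
structure IsHeckeCoord {A : Type*} [CommRing A] (ι : NabRing →+* A) (coord : A →+ NabRing)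
    (h a b g : A) : Prop where
  coord_mul : ∀ f z, coord (ι f * z) = f * coord z
  coord_one : coord 1 = 1
  coord_h : coord h = 0
  a_eq : a = ι (MvPolynomial.C (1 / 2) * nabα)
  b_eq : b = ι (MvPolynomial.C (1 / 4) * nabβ)
  g_eq : g = ι (MvPolynomial.C (1 / 2) * nabγ)
  sq_eq : (h - a) ^ 2 = b

namespace IsHeckeCoord

variable {A : Type*} [CommRing A] {ι : NabRing →+* A} {coord : A →+ NabRing} {h a b g : A}

theorem coord_term (H : IsHeckeCoord ι coord h a b g) (j m n p : ℕ) :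
    coord ((h - a) ^ j * a ^ m * (b ^ n * g ^ p)) =
      MvPolynomial.C ((-1) ^ j / (2 ^ (m + j % 2 + 2 * (n + j / 2) + p))) *
        (nabα ^ (m + j % 2) * nabβ ^ (n + j / 2) * nabγ ^ p) := by
  have hj : (h - a) ^ j = (h - a) ^ (j % 2) * b ^ (j / 2) := by
    rw [← H.sq_eq, ← pow_mul, ← pow_add, Nat.mod_add_div]
  have hm : (h - a) ^ j * a ^ m * (b ^ n * g ^ p) =
    ι ((MvPolynomial.C (1 / 2) * nabα) ^ m * (MvPolynomial.C (1 / 4) * nabβ) ^ (n + j / 2) *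
      (MvPolynomial.C (1 / 2) * nabγ) ^ p) * (h - a) ^ (j % 2) := by
    rw [hj, map_mul, map_mul, map_pow, map_pow, map_pow, ← H.a_eq, ← H.b_eq, ← H.g_eq]
    ring
  have hr : coord ((h - a) ^ (j % 2)) = MvPolynomial.C ((-1 / 2) ^ (j % 2)) * nabα ^ (j % 2) := by
    rcases Nat.mod_two_eq_zero_or_one j with hj | hj <;> rw [hj]
    · simpa using H.coord_one
    · have := H.coord_mul (MvPolynomial.C (1 / 2) * nabα) 1
      rw [mul_one, ← H.a_eq, H.coord_one, mul_one] at this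
      rw [pow_one, map_sub, H.coord_h, this, pow_one, pow_one, zero_sub, ← neg_mul,
        ← map_neg, neg_div]
  have hs : (-1 : ℚ) ^ j / (2 ^ (m + j % 2 + 2 * (n + j / 2) + p)) =
      (1 / 2) ^ m * (1 / 4) ^ (n + j / 2) * (1 / 2) ^ p * (-1 / 2) ^ (j % 2) := by
    rw [show (1 / 4 : ℚ) = (1 / 2) ^ 2 by norm_num, ← pow_mul, neg_div, neg_pow (1 / 2 : ℚ),
      ← neg_one_pow_eq_pow_mod_two j]
    simp only [pow_add, one_div, inv_pow]
    field_simp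
  rw [hm, H.coord_mul, hr, hs]
  simp only [map_mul, map_pow, mul_pow, pow_add]
  ring

theorem integral_term (H : IsHeckeCoord ι coord h a b g) (Λ : NabRing →ₗ[ℚ] ℚ)
    (hΛ : ∀ m n p, Λ (nabα ^ m * nabβ ^ n * nabγ ^ p) = thaddeus m n p) (k n p : ℕ) :
    Λ (coord (h ^ k * (b ^ n * g ^ p))) = heckeIntegral k n p := by
  rw [← sub_add_cancel h a, add_pow, Finset.sum_mul, map_sum, map_sum]
  refine Finset.sum_congr rfl fun j _ => ?_
  rw [mul_right_comm, mul_comm, ← nsmul_eq_mul, map_nsmul, H.coord_term,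
    ← MvPolynomial.smul_eq_C_mul, map_nsmul, map_smul, hΛ, nsmul_eq_mul, smul_eq_mul]
  ring

theorem integral_eval (H : IsHeckeCoord ι coord h a b g) (Λ : NabRing →ₗ[ℚ] ℚ)
    (hΛ : ∀ m n p, Λ (nabα ^ m * nabβ ^ n * nabγ ^ p) = thaddeus m n p) (l : TermList) :
    Λ (coord (l.eval h b g)) = (l.map fun (v, k, n, p) => v * heckeIntegral k n p).sum := by
  induction l with
  | nil => simp [TermList.eval]
  | cons t l ih =>
    obtain ⟨v, k, n, p⟩ := t
    simp only [TermList.eval, List.map_cons, List.sum_cons, map_add] at ih ⊢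
    rw [ih, mul_assoc, mul_assoc, ← zsmul_eq_mul, map_zsmul, map_zsmul, H.integral_term Λ hΛ,
      zsmul_eq_mul]

theorem integral_det (H : IsHeckeCoord ι coord h a b g) (c : ℕ → A)
    (hc0 : c 0 = 2) (hc1 : c 1 = h) (hc2 : c 2 = ι (MvPolynomial.C (1 / 2)) * h ^ 2)
    (hc3 : c 3 = ι (MvPolynomial.C (1 / 3)) * (ι (MvPolynomial.C (1 / 2)) * h ^ 3
      + ι (MvPolynomial.C (1 / 4)) * ι nabβ * h - ι (MvPolynomial.C (1 / 2)) * ι nabγ))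
    (hc4 : c 4 = ι (MvPolynomial.C (1 / 4)) * (ι (MvPolynomial.C (1 / 6)) * h ^ 4
      + ι (MvPolynomial.C (1 / 3)) * ι nabβ * h ^ 2
      - ι (MvPolynomial.C (2 / 3)) * ι nabγ * h))
    (hrec : ∀ n : ℕ, 1 ≤ n →
      ι (MvPolynomial.C ((n : ℚ) + 4)) * c (n + 4)
        - ι (MvPolynomial.C (((n : ℚ) + 2) / 2)) * ι nabβ * c (n + 2)
        + (ι (MvPolynomial.C (1 / 16)) * ι nabβ ^ 2) * ι (MvPolynomial.C (n : ℚ)) * c n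
      = h * c (n + 3) - (ι (MvPolynomial.C (1 / 4)) * ι nabβ * h
        + ι (MvPolynomial.C (1 / 2)) * ι nabγ) * c (n + 1))
    (Λ : NabRing →ₗ[ℚ] ℚ)
    (hΛ : ∀ m n p, Λ (nabα ^ m * nabβ ^ n * nabγ ^ p) = thaddeus m n p) :
    Λ (coord (Matrix.det
      !![c 8, c 9, c 10, c 11, c 12, c 13, c 14, c 15;
         c 6, c 7, c 8,  c 9,  c 10, c 11, c 12, c 13;
         c 4, c 5, c 6,  c 7,  c 8,  c 9,  c 10, c 11;
         c 2, c 3, c 4,  c 5,  c 6,  c 7,  c 8,  c 9;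
         c 0, c 1, c 2,  c 3,  c 4,  c 5,  c 6,  c 7;
         0,   0,   c 0,  c 1,  c 2,  c 3,  c 4,  c 5;
         0,   0,   0,    0,    c 0,  c 1,  c 2,  c 3;
         0,   0,   0,    0,    0,    0,    c 0,  c 1])) = -6 := by
  set q : ℚ →+* A := ι.comp MvPolynomial.C with hq
  have hqC (x : ℚ) : ι (MvPolynomial.C x) = q x := rfl
  simp only [hqC] at hc2 hc3 hc4 hrec
  have q2 : 2 * q (1 / 2) = 1 := by rw [← map_ofNat q 2, ← map_mul]; norm_num
  have q3 : 3 * q (1 / 3) = 1 := by rw [← map_ofNat q 3, ← map_mul]; norm_num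
  have q4 : q (1 / 4) = q (1 / 2) ^ 2 := by rw [← map_pow]; norm_num
  have q6 : q (1 / 6) = q (1 / 2) * q (1 / 3) := by rw [← map_mul]; norm_num
  have q23 : q (2 / 3) = 2 * q (1 / 3) := by rw [← map_ofNat q 2, ← map_mul]; norm_num
  have q16 : q (1 / 16) = q (1 / 4) ^ 2 := by rw [← map_pow]; norm_num
  have q4' : 4 * q (1 / 4) = 1 := by rw [← map_ofNat q 4, ← map_mul]; norm_num
  have hβ : ι nabβ = 4 * b := by
    rw [H.b_eq, map_mul, hqC]
    linear_combination -ι nabβ * q4'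
  have hγ : ι nabγ = 2 * g := by
    rw [H.g_eq, map_mul, hqC]
    linear_combination -ι nabγ * q2
  rw [hβ] at hc3 hc4 hrec
  rw [hγ] at hc3 hc4 hrec
  have e := factorial_mul_chern (b := b) (g := g) hc0 hc1
    (by rw [hc2]; linear_combination h ^ 2 * q2)
    (by
      rw [hc3]
      linear_combination (h ^ 3 + 2 * h * b - 2 * g) * q3
        + 3 * q (1 / 3) * ((h ^ 3 - 2 * g) * q2 + 2 * b * h * q4'))
    (by
      rw [hc4, q6, q23]
      linear_combination (h ^ 4 + 8 * h ^ 2 * b - 8 * h * g) * q3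
        + 3 * q (1 / 3) * (8 * h ^ 2 * b - 8 * h * g) * q4'
        + 3 * q (1 / 3) * h ^ 4 * (q2 + 2 * q (1 / 2) * q4'))
    (fun n hn => by
      have hn2 : q (((n : ℚ) + 2) / 2) = (n + 2) * q (1 / 2) := by
        rw [div_eq_mul_one_div, map_mul, map_add, map_natCast, map_ofNat]
      have := hrec n hn
      rw [hn2, q16, map_add, map_natCast, map_ofNat] at this
      linear_combination this + 2 * (n + 2) * b * c (n + 2) * q2
        - n * b ^ 2 * c n * (4 * q (1 / 4) + 1) * q4'
        - (b * h * q4' + g * q2) * c (n + 1))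
  have hdet := det_mul_pow_eq_hankel c _ _ (sum_mul_quotTerms q e)
  have hc8 : c 0 ^ 8 = 2 ^ 8 := by rw [hc0]
  rw [det_hankel_quotTerms h b g (fun n => (quotTerms n).eval h b g) fun _ => rfl, hc8] at hdet
  have hnum : (hankelTerms.map fun (v, k, n, p) => v * heckeIntegral k n p).sum
      * (2 ^ 8 * 219337790953881600000) = -6 * 20922789888000 ^ 4 := by
    decide +kernel
  rw [← H.integral_eval Λ hΛ] at hnum
  have hK (N : ℕ) (z : A) : Λ (coord (z * (N : A))) = Λ (coord z) * N := by
    rw [mul_comm, ← nsmul_eq_mul, map_nsmul, map_nsmul, nsmul_eq_mul, mul_comm]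
  suffices h_int : ∀ D : A, D * 20922789888000 ^ 4 =
      2 ^ 8 * (219337790953881600000 * hankelTerms.eval h b g) → Λ (coord D) = -6 from
    h_int _ hdet
  clear hdet
  intro D hdet
  have hD : D * ((20922789888000 ^ 4 : ℕ) : A) =
      hankelTerms.eval h b g * ((2 ^ 8 * 219337790953881600000 : ℕ) : A) := by
    push_cast
    linear_combination hdet
  have hL := congrArg (fun z => Λ (coord z)) hD
  simp only [hK] at hL
  push_cast at hL
  exact mul_right_cancel₀ (b := (20922789888000 : ℚ) ^ 4) (by norm_num) (by linarith)

end IsHeckeCoord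

end Integrals

section Basis

theorem nabRel_monic : nabRel.Monic := by
  unfold nabRel
  monicity!

theorem nabRel_natDegree : nabRel.natDegree = 2 := by
  unfold nabRel
  compute_degree!

/-- The coefficient at `1` with respect to the basis `{1, h}` of `S` over `R`. -/
def nabCoord : NabS →ₗ[NabRing] NabRing :=
  (Polynomial.lcoeff NabRing 0).comp (AdjoinRoot.modByMonicHom nabRel_monic)

theorem nabCoord_apply (f u : NabRing) : nabCoord (nabι f + nabι u * nabH) = f := by
  have h : AdjoinRoot.modByMonicHom nabRel_monic
      (AdjoinRoot.mk nabRel (Polynomial.C f + Polynomial.C u * Polynomial.X)) =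
        Polynomial.C f + Polynomial.C u * Polynomial.X := by
    rw [AdjoinRoot.modByMonicHom_mk, Polynomial.modByMonic_eq_self_iff nabRel_monic]
    rw [Polynomial.degree_eq_natDegree nabRel_monic.ne_zero, nabRel_natDegree, add_comm]
    exact Polynomial.degree_linear_le.trans_lt (by norm_num)
  change Polynomial.coeff (AdjoinRoot.modByMonicHom nabRel_monic
      (AdjoinRoot.mk nabRel (Polynomial.C f + Polynomial.C u * Polynomial.X))) 0 = f
  rw [h]
  simp

theorem nabCoord_mul (f : NabRing) (z : NabS) : nabCoord (nabι f * z) = f * nabCoord z := by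
  have h : nabι f * z = f • z := by
    obtain ⟨z, rfl⟩ := Ideal.Quotient.mk_surjective z
    change Ideal.Quotient.mk _ (Polynomial.C f * z) = Ideal.Quotient.mk _ (f • z)
    rw [Polynomial.smul_eq_C_mul]
  rw [h, map_smul, smul_eq_mul]

theorem nabH_sq : nabH ^ 2 = nabι nabα * nabH - nabQ (1/4) * (nabι nabα ^ 2 - nabι nabβ) := by
  have h : Ideal.Quotient.mk (Ideal.span {nabRel})
      (Polynomial.X ^ 2 - Polynomial.C nabα * Polynomial.X +
        Polynomial.C (MvPolynomial.C (1/4 : ℚ) * (nabα ^ 2 - nabβ))) = 0 :=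
    Ideal.Quotient.eq_zero_iff_mem.2 (Ideal.mem_span_singleton_self _)
  have h' : nabH ^ 2 - nabι nabα * nabH + nabQ (1/4) * (nabι nabα ^ 2 - nabι nabβ) = 0 := by
    rw [← h]
    simp only [map_add, map_sub, map_mul, map_pow]
    rfl
  linear_combination h'

theorem isHeckeCoord_nab : IsHeckeCoord nabι nabCoord.toAddMonoidHom nabH
    (nabι (MvPolynomial.C (1 / 2) * nabα)) (nabι (MvPolynomial.C (1 / 4) * nabβ))
    (nabι (MvPolynomial.C (1 / 2) * nabγ)) where
  coord_mul := nabCoord_mul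
  coord_one := by
    have h := nabCoord_apply 1 0
    rwa [show nabι 1 + nabι 0 * nabH = 1 by rw [map_one, map_zero]; ring] at h
  coord_h := by
    have h := nabCoord_apply 0 1
    rwa [show nabι 0 + nabι 1 * nabH = nabH by rw [map_one, map_zero]; ring] at h
  a_eq := rfl
  b_eq := rfl
  g_eq := rfl
  sq_eq := by
    have h : nabι (MvPolynomial.C (1 / 2)) ^ 2 = nabι (MvPolynomial.C (1 / 4)) := by
      rw [← map_pow, ← map_pow]; norm_num
    have h2 : 2 * nabι (MvPolynomial.C (1 / 2)) = 1 := by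
      rw [← map_ofNat nabι 2, ← map_ofNat MvPolynomial.C 2, ← map_mul, ← map_mul]; norm_num
    have hH := nabH_sq
    rw [nabQ] at hH
    rw [map_mul, map_mul]
    linear_combination hH + nabι nabα ^ 2 * h - nabι nabα * nabH * h2

end Basis

/-- **Computational core of Theorem thm:3bundles.**  With `c₀ = 2`, `c₁ = h`,
`c₂ = h²/2`, `c₃ = (1/3)(h³/2 + βh/4 - γ/2)`, `c₄ = (1/4)(h⁴/6 + βh²/3 - 2γh/3)` and
the recursion `(n+4)c_{n+4} - ((n+2)/2)βc_{n+2} + (β/4)²·n·c_n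
= h·c_{n+3} - (βh/4 + γ/2)c_{n+1}` for `n ≥ 1`, write the 8×8 Lagrangian
degeneracy-locus determinant as `D = f + u·h` with `f, u ∈ R`.  If `Λ : R → ℚ` is
the ℚ-linear functional given on monomials by Thaddeus' formula
`Λ(α^m β^n γ^p) = (-1)^(13-p) · 13!·m!/((13-p)!·q!) · 2^(24-p) · (2^q - 2) · B_q`
for `m + 2n + 3p = 36` and `q = m + p - 12 ≥ 0` (and `0` otherwise), then
`Λ(f) = -6`. -/
theorem stmt_6
    (c : ℕ → NabS)
    (hc0 : c 0 = 2) (hc1 : c 1 = nabH)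
    (hc2 : c 2 = nabQ (1/2) * nabH ^ 2)
    (hc3 : c 3 = nabQ (1/3) *
      (nabQ (1/2) * nabH ^ 3 + nabQ (1/4) * nabι nabβ * nabH - nabQ (1/2) * nabι nabγ))
    (hc4 : c 4 = nabQ (1/4) *
      (nabQ (1/6) * nabH ^ 4 + nabQ (1/3) * nabι nabβ * nabH ^ 2
        - nabQ (2/3) * nabι nabγ * nabH))
    (hrec : ∀ n : ℕ, 1 ≤ n →
      nabQ ((n : ℚ) + 4) * c (n + 4)
        - nabQ (((n : ℚ) + 2) / 2) * nabι nabβ * c (n + 2)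
        + (nabQ (1/16) * nabι nabβ ^ 2) * nabQ (n : ℚ) * c n
      = nabH * c (n + 3)
        - (nabQ (1/4) * nabι nabβ * nabH + nabQ (1/2) * nabι nabγ) * c (n + 1))
    (f u : NabRing)
    (hfu : Matrix.det
      !![c 8, c 9, c 10, c 11, c 12, c 13, c 14, c 15;
         c 6, c 7, c 8,  c 9,  c 10, c 11, c 12, c 13;
         c 4, c 5, c 6,  c 7,  c 8,  c 9,  c 10, c 11;
         c 2, c 3, c 4,  c 5,  c 6,  c 7,  c 8,  c 9;
         c 0, c 1, c 2,  c 3,  c 4,  c 5,  c 6,  c 7;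
         0,   0,   c 0,  c 1,  c 2,  c 3,  c 4,  c 5;
         0,   0,   0,    0,    c 0,  c 1,  c 2,  c 3;
         0,   0,   0,    0,    0,    0,    c 0,  c 1]
      = nabι f + nabι u * nabH)
    (Λ : NabRing →ₗ[ℚ] ℚ)
    (hΛ : ∀ m n p : ℕ,
      Λ (nabα ^ m * nabβ ^ n * nabγ ^ p) =
        if m + 2 * n + 3 * p = 36 ∧ 12 ≤ m + p then
          (-1 : ℚ) ^ (13 - p) *
            ((Nat.factorial 13 : ℚ) * (Nat.factorial m : ℚ)) /
              ((Nat.factorial (13 - p) : ℚ) * (Nat.factorial (m + p - 12) : ℚ)) *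
            2 ^ (24 - p) * (2 ^ (m + p - 12) - 2) * bernoulli (m + p - 12)
        else 0) :
    Λ f = -6 := by
  have hΛ' (m n p : ℕ) : Λ (nabα ^ m * nabβ ^ n * nabγ ^ p) = thaddeus m n p := by
    rw [hΛ, thaddeus]
    split_ifs with h
    · rw [bernoulli_eq_bernoulliValue _ (by omega)]
    · rfl
  have h := isHeckeCoord_nab.integral_det c hc0 hc1 hc2 hc3 hc4 hrec Λ hΛ'
  rw [hfu] at h
  rw [← h]
  exact congrArg Λ (nabCoord_apply f u).symm

end
end

section
/- Let K be an algebraically closed field, V a finite-dimensional K-vector space with dim V ≥ 2, W a finite-dimensional K-vector space with dim W ≤ 2·dim V − 4, and φ : ⋀²V → W a K-linear map. Then there exist linearly independent vectors v₁, v₂ ∈ V with φ(v₁ ∧ v₂) = 0. -/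
open MvPolynomial

/-- A consequence of Krull's height theorem and the Nullstellensatz: a rational point of an affine
scheme of finite type that is the only common zero of `m` functions has height at most `m`. -/
theorem height_ker_le_card_of_unique_zero {K A ι : Type*} [Field K] [IsAlgClosed K] [CommRing A]
    [Algebra K A] [Algebra.FiniteType K A] [Fintype ι] (l : ι → A) (ψ₀ : A →ₐ[K] K)
    (h₀ : ∀ k, ψ₀ (l k) = 0) (huniq : ∀ ψ : A →ₐ[K] K, (∀ k, ψ (l k) = 0) → ψ = ψ₀) :
    (RingHom.ker ψ₀).height ≤ Fintype.card ι := by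
  have : IsNoetherianRing A := Algebra.FiniteType.isNoetherianRing K A
  have : IsJacobsonRing A := isJacobsonRing_of_finiteType (A := K)
  have key : ∀ M : Ideal A, M.IsMaximal → (∀ k, l k ∈ M) → M = RingHom.ker ψ₀ := by
    intro M hM hl
    let := Ideal.Quotient.field M
    have : Module.Finite K (A ⧸ M) := finite_of_finite_type_of_isJacobsonRing K (A ⧸ M)
    let e : K ≃ₐ[K] A ⧸ M := AlgEquiv.ofBijective (Algebra.ofId K (A ⧸ M))
      IsAlgClosed.algebraMap_bijective_of_isIntegral
    have hker : ∀ x, e.symm (Ideal.Quotient.mk M x) = 0 ↔ x ∈ M := fun x ↦ by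
      rw [map_eq_zero_iff _ e.symm.injective, Ideal.Quotient.eq_zero_iff_mem]
    have hψ := huniq (e.symm.toAlgHom.comp (Ideal.Quotient.mkₐ K M)) fun k ↦ (hker _).2 (hl k)
    ext x
    rw [RingHom.mem_ker, ← hψ]
    exact (hker x).symm
  have hmin : RingHom.ker ψ₀ ∈ (Ideal.span (Set.range l)).minimalPrimes := by
    refine ⟨⟨RingHom.ker_isPrime _, ?_⟩, ?_⟩
    · rw [Ideal.span_le]
      rintro _ ⟨k, rfl⟩
      exact h₀ k
    · rintro q ⟨hq, hle⟩ -
      rw [← hq.isRadical.radical, Ideal.radical_eq_jacobson]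
      refine le_sInf fun M ⟨hqM, hM⟩ ↦ ?_
      exact (key M hM fun k ↦ hqM (hle (Ideal.subset_span ⟨k, rfl⟩))).ge
  refine (Ideal.height_le_card_of_mem_minimalPrimes_span (Set.finite_range l) hmin).trans ?_
  rw [← Nat.card_eq_fintype_card, ← Set.image_univ, ← Set.ncard_univ]
  exact_mod_cast Set.ncard_image_le Set.finite_univ

namespace Plucker

variable (K : Type*) [Field K] (n : ℕ)

/-- The `2 × 2` minors of the generic `2 × n` matrix. -/
noncomputable def minor (i j : Fin n) : MvPolynomial (Fin n ⊕ Fin n) K :=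
  X (.inl i) * X (.inr j) - X (.inl j) * X (.inr i)

/-- The homogeneous coordinate ring of the Grassmannian of planes in `Kⁿ`. -/
noncomputable abbrev coordinateRing : Subalgebra K (MvPolynomial (Fin n ⊕ Fin n) K) :=
  Algebra.adjoin K (Set.range fun ij : Fin n × Fin n ↦ minor K n ij.1 ij.2)

/-- The Plücker coordinates. -/
noncomputable def coord (i j : Fin n) : coordinateRing K n :=
  ⟨minor K n i j, Algebra.subset_adjoin ⟨(i, j), rfl⟩⟩

/-- Truncation of the rows of the generic `2 × n` matrix to their first `a` and first `b`
entries. -/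
noncomputable def truncation (a b : ℕ) :
    MvPolynomial (Fin n ⊕ Fin n) K →ₐ[K] MvPolynomial (Fin n ⊕ Fin n) K :=
  aeval (Sum.elim (fun i ↦ if i.1 < a then X (.inl i) else 0)
    (fun j ↦ if j.1 < b then X (.inr j) else 0))

/-- The ideal of the cone over the Schubert variety of planes spanned by a vector of `K ^ a` and a
vector of `K ^ b`. -/
noncomputable def schubertIdeal (a b : ℕ) : Ideal (coordinateRing K n) :=
  RingHom.ker ((truncation K n a b).comp (coordinateRing K n).val)

instance (a b : ℕ) : (schubertIdeal K n a b).IsPrime := RingHom.ker_isPrime _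

instance : Algebra.FiniteType K (coordinateRing K n) :=
  Subalgebra.fg_iff_finiteType _ |>.1 (Subalgebra.fg_def.2 ⟨_, Set.finite_range _, rfl⟩)

variable {K n}

theorem coord_mul_coord (a b i j : Fin n) :
    coord K n a i * coord K n b j - coord K n a j * coord K n b i =
      coord K n a b * coord K n i j := by
  apply Subtype.ext
  simp only [coord, minor, AddSubgroupClass.coe_sub, MulMemClass.coe_mul]
  ring

theorem coord_self (i : Fin n) : coord K n i i = 0 := by
  apply Subtype.ext
  simp [coord, minor]

theorem coord_swap (i j : Fin n) : coord K n j i = -coord K n i j := by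
  apply Subtype.ext
  simp [coord, minor]

theorem algHom_ext {B : Type*} [CommRing B] [Algebra K B] {f g : coordinateRing K n →ₐ[K] B}
    (h : ∀ i j, f (coord K n i j) = g (coord K n i j)) : f = g := by
  refine AlgHom.adjoin_ext ?_
  rintro _ ⟨⟨i, j⟩, rfl⟩
  exact h i j

theorem mem_schubertIdeal {a b : ℕ} {x : coordinateRing K n} :
    x ∈ schubertIdeal K n a b ↔ truncation K n a b x = 0 := Iff.rfl

theorem truncation_comp_truncation {a b a' b' : ℕ} (ha : a' ≤ a) (hb : b' ≤ b) :
    (truncation K n a' b').comp (truncation K n a b) = truncation K n a' b' := by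
  refine MvPolynomial.algHom_ext fun i ↦ ?_
  rcases i with i | i <;> simp only [truncation, AlgHom.comp_apply, aeval_X, Sum.elim_inl,
    Sum.elim_inr] <;> split_ifs <;> simp <;> omega

theorem schubertIdeal_anti {a b a' b' : ℕ} (ha : a' ≤ a) (hb : b' ≤ b) :
    schubertIdeal K n a b ≤ schubertIdeal K n a' b' := by
  intro x hx
  rw [mem_schubertIdeal] at hx ⊢
  rw [← truncation_comp_truncation ha hb, AlgHom.comp_apply, hx, map_zero]

theorem schubertIdeal_lt {i j : Fin n} (hij : i < j) {a b : ℕ} (ha : a ≤ i + 1) (hb : b ≤ j + 1)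
    (h : a ≤ i ∨ b ≤ j) : schubertIdeal K n (i + 1) (j + 1) < schubertIdeal K n a b := by
  have hij' : i.1 < j.1 := hij
  refine SetLike.lt_iff_le_and_exists.2 ⟨schubertIdeal_anti ha hb, coord K n i j, ?_, ?_⟩
  · have : ¬ j.1 < a := by omega
    rw [mem_schubertIdeal]
    rcases h with h | h <;> simp [coord, minor, truncation, this, h.not_gt]
  · rw [mem_schubertIdeal]
    simp [coord, minor, truncation, hij.not_ge, hij.le]

/-- The Schubert cones in the flag `K ^ 1 ∧ K ^ 1 ⊂ K ^ 1 ∧ K ^ 2 ⊂ ⋯ ⊂ K ^ (n - 1) ∧ K ^ n` have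
strictly decreasing ideals, so that the first one has height at least `2 n - 3`. -/
theorem le_height_schubertIdeal_one_one (hn : 2 ≤ n) :
    ((2 * n - 3 : ℕ) : ℕ∞) ≤ (schubertIdeal K n 1 1).height := by
  let S (k : ℕ) : Ideal (coordinateRing K n) :=
    schubertIdeal K n (max 1 (k + 2 - n)) (min (k + 1) n)
  have hS : ∀ k, (S k).IsPrime := fun k ↦ inferInstanceAs (schubertIdeal K n _ _).IsPrime
  have hlt : ∀ k, k + 1 ≤ 2 * n - 3 → S (k + 1) < S k := by
    intro k hk
    have h := schubertIdeal_lt (K := K) (n := n)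
      (i := ⟨max 1 (k + 3 - n) - 1, by omega⟩) (j := ⟨min (k + 2) n - 1, by omega⟩)
      (a := max 1 (k + 2 - n)) (b := min (k + 1) n)
      (Fin.mk_lt_mk.2 (by omega)) (by simp only; omega) (by simp only; omega)
      (by simp only; omega)
    convert h using 2 <;> simp only <;> omega
  have hle : ∀ d k, d + k = 2 * n - 3 → (d : ℕ∞) ≤ (S k).height := by
    intro d
    induction d with
    | zero => simp
    | succ d ih =>
      intro k hk
      push_cast
      exact (add_le_add_left (ih (k + 1) (by omega)) 1).trans
        (Ideal.height_add_one_le_of_lt_of_isPrime (hlt k (by omega)))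
  have h0 : S 0 = schubertIdeal K n 1 1 := by
    change schubertIdeal K n _ _ = _
    congr 1 <;> omega
  exact h0 ▸ hle _ 0 rfl

/-- The vertex of the cone over the Grassmannian. -/
noncomputable def vertex : coordinateRing K n →ₐ[K] K :=
  (aeval fun _ ↦ 0).comp (coordinateRing K n).val

theorem vertex_coord (i j : Fin n) : vertex (coord K n i j) = 0 := by
  simp [vertex, coord, minor]

theorem ker_vertex : RingHom.ker (vertex (K := K) (n := n)) = schubertIdeal K n 1 1 := by
  have h : (Algebra.ofId K (MvPolynomial (Fin n ⊕ Fin n) K)).comp vertex =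
      (truncation K n 1 1).comp (coordinateRing K n).val := by
    refine algHom_ext fun i j ↦ ?_
    rw [AlgHom.comp_apply, vertex_coord, map_zero]
    by_cases hi : i.1 = 0 <;> by_cases hj : j.1 = 0 <;>
      simp [coord, minor, truncation, hi, hj]
    obtain rfl : i = j := Fin.ext (hi.trans hj.symm)
    simp
  ext x
  rw [schubertIdeal, ← h, RingHom.mem_ker, RingHom.mem_ker, AlgHom.comp_apply]
  exact (map_eq_zero_iff _ (algebraMap K _).injective).symm

/-- Any `m < 2 n - 3` linear forms in the Plücker coordinates have a common zero on the cone over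
the Grassmannian other than its vertex. -/
theorem exists_algHom_ne_zero [IsAlgClosed K] {ι : Type*} [Fintype ι] (hn : 2 ≤ n)
    (hι : Fintype.card ι < 2 * n - 3) (c : ι → Fin n → Fin n → K) :
    ∃ ψ : coordinateRing K n →ₐ[K] K,
      (∀ k, ∑ i, ∑ j, c k i j * ψ (coord K n i j) = 0) ∧ ∃ i j, ψ (coord K n i j) ≠ 0 := by
  by_contra! H
  have h := height_ker_le_card_of_unique_zero
    (fun k ↦ ∑ i, ∑ j, c k i j • coord K n i j) vertex (by simp [vertex_coord])
    fun ψ hψ ↦ algHom_ext fun i j ↦ by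
      rw [vertex_coord, H ψ fun k ↦ by simpa using hψ k]
  rw [ker_vertex] at h
  exact hι.not_ge (by exact_mod_cast (le_height_schubertIdeal_one_one hn).trans h)

end Plucker

theorem Finset.sum_sum_eq_sum_sum_ite_lt {ι M : Type*} [Fintype ι] [LinearOrder ι]
    [AddCommMonoid M] (f : ι → ι → M) (hf : ∀ i, f i i = 0) :
    ∑ i, ∑ j, f i j = ∑ i, ∑ j, if i < j then f i j + f j i else 0 := by
  have h : ∀ i j, f i j = (if i < j then f i j else 0) + if j < i then f i j else 0 := by
    intro i j
    rcases lt_trichotomy i j with h | rfl | h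
    · simp [h, h.not_gt]
    · simp [hf]
    · simp [h, h.not_gt]
  simp_rw [ite_add_zero, Finset.sum_add_distrib]
  rw [Finset.sum_comm (f := fun i j ↦ if i < j then f j i else 0)]
  simp_rw [← Finset.sum_add_distrib]
  exact Finset.sum_congr rfl fun i _ ↦ Finset.sum_congr rfl fun j _ ↦ h i j

/-- The Grassmannian of planes in `V` meets every linear subspace of codimension at most
`2 * dim V - 4`. -/
theorem LinearMap.IsAlt.exists_linearIndependent_pair_eq_zero {K V W : Type*} [Field K]
    [IsAlgClosed K] [AddCommGroup V] [Module K V] [FiniteDimensional K V]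
    [AddCommGroup W] [Module K W] [FiniteDimensional K W] {B : V →ₗ[K] V →ₗ[K] W} (hB : B.IsAlt)
    (hV : 2 ≤ Module.finrank K V) (hW : Module.finrank K W ≤ 2 * Module.finrank K V - 4) :
    ∃ v w : V, LinearIndependent K ![v, w] ∧ B v w = 0 := by
  let e := Module.finBasis K V
  let f := Module.finBasis K W
  obtain ⟨ψ, hψ, a, b, hψab⟩ := Plucker.exists_algHom_ne_zero (K := K) hV
    (ι := Fin (Module.finrank K W)) (by rw [Fintype.card_fin]; omega)
    (fun k i j ↦ if i < j then f.repr (B (e i) (e j)) k else 0)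
  let z := fun i j ↦ ψ (Plucker.coord K _ i j)
  have hz (i j k l) : z i k * z j l - z i l * z j k = z i j * z k l := by
    simpa using congrArg ψ (Plucker.coord_mul_coord i j k l)
  have hself (i) : z i i = 0 := by simp [z, Plucker.coord_self]
  have hswap : z b a = -z a b := by simp only [z]; rw [Plucker.coord_swap, map_neg]
  have hab : z a b ≠ 0 := hψab
  refine ⟨∑ i, z a i • e i, ∑ j, z b j • e j, ?_, ?_⟩
  · refine LinearIndependent.pair_iff.2 fun s t hst ↦ ?_
    have h (k) : s * z a k + t * z b k = 0 := by
      simpa [Finsupp.single_apply] using congrArg (fun v ↦ e.repr v k) hst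
    have h₁ := h a
    have h₂ := h b
    rw [hself, hswap] at h₁
    rw [hself] at h₂
    simpa [hab] using And.intro h₂ h₁
  · have hsum : ∑ i, ∑ j, (if i < j then z i j • B (e i) (e j) else 0) = 0 := by
      refine f.ext_elem fun k ↦ ?_
      rw [map_zero, Finsupp.zero_apply, ← hψ k]
      simp only [map_sum, Finsupp.finsetSum_apply]
      refine Finset.sum_congr rfl fun i _ ↦ Finset.sum_congr rfl fun j _ ↦ ?_
      split_ifs <;> simp [z, mul_comm]
    calc B (∑ i, z a i • e i) (∑ j, z b j • e j)
        = ∑ i, ∑ j, (z a i * z b j) • B (e i) (e j) := by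
          simp only [map_sum, map_smul, LinearMap.sum_apply, LinearMap.smul_apply,
            Finset.smul_sum]
          rw [Finset.sum_comm]
          simp only [mul_smul, smul_comm (z b _) (z a _)]
      _ = ∑ i, ∑ j, (if i < j then
            (z a i * z b j) • B (e i) (e j) + (z a j * z b i) • B (e j) (e i) else 0) :=
          Finset.sum_sum_eq_sum_sum_ite_lt _ fun i ↦ by rw [hB.self_eq_zero, smul_zero]
      _ = z a b • ∑ i, ∑ j, (if i < j then z i j • B (e i) (e j) else 0) := by
          simp_rw [Finset.smul_sum, smul_ite, smul_zero, smul_smul, ← hz a b]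
          refine Finset.sum_congr rfl fun i _ ↦ Finset.sum_congr rfl fun j _ ↦ ?_
          rw [← hB.neg (e i) (e j), smul_neg, sub_smul, sub_eq_add_neg]
      _ = 0 := by rw [hsum, smul_zero]

/-- **Linear-algebra fact used in prop:extension and prop:tsu.** Let `K` be an
algebraically closed field, `V` a finite-dimensional `K`-vector space with
`dim V ≥ 2`, and `W` a finite-dimensional `K`-vector space with
`dim W ≤ 2·dim V - 4`.  Then every `K`-linear map `φ : ⋀²V → W` vanishes on some
nonzero pure tensor `v₁ ∧ v₂` with `v₁, v₂` linearly independent. -/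
theorem stmt_11 {K V W : Type*} [Field K] [IsAlgClosed K]
    [AddCommGroup V] [Module K V] [FiniteDimensional K V]
    [AddCommGroup W] [Module K W] [FiniteDimensional K W]
    (hV : 2 ≤ Module.finrank K V)
    (hW : Module.finrank K W ≤ 2 * Module.finrank K V - 4)
    (φ : ⋀[K]^2 V →ₗ[K] W) :
    ∃ v₁ v₂ : V, LinearIndependent K ![v₁, v₂] ∧
      φ ⟨ExteriorAlgebra.ιMulti K 2 ![v₁, v₂],
         ExteriorAlgebra.ιMulti_range K 2 (Set.mem_range_self _)⟩ = 0 := by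
  let g : V [⋀^Fin 2]→ₗ[K] W := φ.compAlternatingMap (exteriorPower.ιMulti K 2)
  have hupdate (v x y : V) : Function.update ![v, x] 1 y = ![v, y] := by
    ext i; fin_cases i <;> rfl
  let B : V →ₗ[K] V →ₗ[K] W := LinearMap.mk₂ K (fun v w ↦ g ![v, w])
    (fun v₁ v₂ w ↦ by simpa using g.map_vecCons_add ![w] v₁ v₂)
    (fun c v w ↦ by simpa using g.map_vecCons_smul ![w] c v)
    (fun v w₁ w₂ ↦ by simpa only [hupdate] using g.map_update_add ![v, 0] 1 w₁ w₂)
    (fun c v w ↦ by simpa only [hupdate] using g.map_update_smul ![v, 0] 1 c w)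
  have hB : B.IsAlt := fun v ↦ g.map_eq_zero_of_eq ![v, v] (i := 0) (j := 1) rfl (by decide)
  exact hB.exists_linearIndependent_pair_eq_zero hV hW
end
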